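/- arXiv:2504.07347 — 2 statements merged into one kernel-verified Lean document; each statement's English description precedes it below -/
import Mathlib

section
/- Let f : ℝ → ℝ be a Lipschitz function with f(t) ≥ 0 for all t ≥ 0, and let δ > 0. Suppose that for almost every t > 0 at which f is differentiable, f(t) > 0 implies f'(t) ≤ −δ. Then f(t) = 0 for every t ≥ f(0)/δ. -/
open MeasureTheory

/-- A Lipschitz function whose derivative is almost everywhere at most `c` on an interval grows
at most at rate `c` there. -/
theorem LipschitzWith.sub_le_mul_of_ae_deriv_le {f : ℝ → ℝ} {K : NNReal}
    (hf : LipschitzWith K f) {a b c : ℝ} (hab : a ≤ b)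
    (h : ∀ᵐ x ∂(volume : Measure ℝ), x ∈ Set.Ioo a b → deriv f x ≤ c) :
    f b - f a ≤ c * (b - a) := by
  have hac : AbsolutelyContinuousOnInterval f a b :=
    hf.lipschitzOnWith.absolutelyContinuousOnInterval
  have hle : (fun x ↦ deriv f x) ≤ᵐ[volume.restrict (Set.Icc a b)] fun _ ↦ c := by
    rw [← restrict_Ioo_eq_restrict_Icc]
    exact (ae_restrict_iff' measurableSet_Ioo).2 h
  have hint := intervalIntegral.integral_mono_ae_restrict hab hac.intervalIntegrable_deriv
    intervalIntegrable_const hle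
  rw [hac.integral_deriv_eq_sub, intervalIntegral.integral_const, smul_eq_mul] at hint
  linarith

/-- Fluid calculus lemma: a nonnegative Lipschitz function whose derivative is at most `-δ`
(almost everywhere, at differentiability points where the function is positive) hits zero by
time `f 0 / δ` and stays at zero. -/
theorem stmt0 (f : ℝ → ℝ) (K : NNReal) (hlip : LipschitzWith K f)
    (hnonneg : ∀ t : ℝ, 0 ≤ t → 0 ≤ f t) (δ : ℝ) (hδ : 0 < δ)
    (hdrift : ∀ᵐ t ∂(volume : Measure ℝ),
      0 < t → DifferentiableAt ℝ f t → 0 < f t → deriv f t ≤ -δ) :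
    ∀ t : ℝ, f 0 / δ ≤ t → f t = 0 := by
  intro t ht
  have ht0 : 0 ≤ t := (div_nonneg (hnonneg 0 le_rfl) hδ.le).trans ht
  have decay : ∀ s, 0 ≤ s → s ≤ t → (∀ x ∈ Set.Ioo s t, 0 < f x) →
      f t - f s ≤ -δ * (t - s) := by
    intro s hs hst hpos
    apply hlip.sub_le_mul_of_ae_deriv_le hst
    filter_upwards [hdrift, hlip.ae_differentiableAt_real] with x hx hdiff hmem
    exact hx (hs.trans_lt hmem.1) hdiff (hpos x hmem)
  refine le_antisymm ?_ (hnonneg t ht0)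
  by_cases hzero : (Set.Icc 0 t ∩ f ⁻¹' {0}).Nonempty
  · obtain ⟨s, ⟨⟨hs0, hst⟩, hfs⟩, hmax⟩ :=
      (isCompact_Icc.inter_right
        (isClosed_singleton.preimage hlip.continuous)).exists_isGreatest hzero
    have hfs' : f s = 0 := hfs
    have hd := decay s hs0 hst fun x hx ↦
      (hnonneg x (hs0.trans hx.1.le)).lt_of_ne fun h ↦
        hx.1.not_ge (hmax ⟨⟨hs0.trans hx.1.le, hx.2.le⟩, h.symm⟩)
    nlinarith
  · have hd := decay 0 le_rfl ht0 fun x hx ↦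
      (hnonneg x hx.1.le).lt_of_ne fun h ↦ hzero ⟨x, ⟨hx.1.le, hx.2.le⟩, h.symm⟩
    rw [div_le_iff₀ hδ] at ht
    linarith
end

section
/- Let b be a positive integer and let L, λ, ε be positive reals with ε ≤ L·λ. Set M = (4Lλ/ε)·b and B = 2b·M² + b. Let Q be a finite index set and p, d : Q → ℕ with d_i ≥ 1 for every i ∈ Q. Suppose (i) Σ_{i∈Q} p_i + |{i ∈ Q : p_i = 0}| < b, and (ii) Σ_{i∈Q} ( p_i + d_i + ε·(d_i+1)²/(4Lλ) ) ≥ B. Then there exists i ∈ Q with d_i ≥ M, and consequently ε·(2·max_{i∈Q} d_i − 1)/(4Lλ) ≥ b. -/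
theorem card_le_sum_add_card_filter_eq_zero {ι : Type*} (Q : Finset ι) (p : ι → ℕ) :
    Q.card ≤ (∑ i ∈ Q, p i) + (Q.filter fun i => p i = 0).card := by
  rw [Finset.card_filter, ← Finset.sum_add_distrib, Finset.card_eq_sum_ones]
  refine Finset.sum_le_sum fun i _ => ?_
  split_ifs <;> omega

/-- Key arithmetic step in the Lyapunov drift proof of throughput optimality of work-conserving
scheduling: if the queue cannot fill a full batch of `b` tokens but the Lyapunov function is at
least `B = 2b·M² + b` with `M = (4Lλ/ε)·b`, then some request has at least `M` unprocessed decode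
tokens, and consequently `ε(2·max_i d_i − 1)/(4Lλ) ≥ b`. -/
theorem stmt6 (b : ℕ) (hb : 0 < b) (L lam eps : ℝ)
    (hL : 0 < L) (hlam : 0 < lam) (heps : 0 < eps) (heL : eps ≤ L * lam)
    {ι : Type*} (Q : Finset ι) (p d : ι → ℕ)
    (hd : ∀ i ∈ Q, 1 ≤ d i)
    (h1 : (∑ i ∈ Q, p i) + (Q.filter fun i => p i = 0).card < b)
    (h2 : (2 * (b : ℝ) * ((4 * L * lam / eps) * b) ^ 2 + b : ℝ)
      ≤ ∑ i ∈ Q, ((p i : ℝ) + (d i : ℝ) + eps * ((d i : ℝ) + 1) ^ 2 / (4 * L * lam))) :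
    (∃ i ∈ Q, (4 * L * lam / eps) * b ≤ (d i : ℝ)) ∧
    (b : ℝ) ≤ eps * (2 * ((Q.sup d : ℕ) : ℝ) - 1) / (4 * L * lam) := by
  obtain ⟨c, hc⟩ : ∃ c, c = 4 * L * lam / eps := ⟨_, rfl⟩
  have hden : 0 < 4 * L * lam := by positivity
  have hc4 : 4 ≤ c := by
    rw [hc, le_div_iff₀ heps]
    linarith
  have hcpos : 0 < c := by linarith
  have hdiv (x : ℝ) : eps * x / (4 * L * lam) = x / c := by
    rw [hc]
    field_simp
  have hb1 : (1 : ℝ) ≤ b := by exact_mod_cast hb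
  obtain ⟨M, hM⟩ : ∃ M, M = c * b := ⟨_, rfl⟩
  have hM4 : 4 ≤ M := by rw [hM]; nlinarith
  simp only [hdiv, ← hc, ← hM] at h2 ⊢
  have hex : ∃ i ∈ Q, M ≤ (d i : ℝ) := by
    by_contra! hlt
    have hcard : Q.card ≤ b := (card_le_sum_add_card_filter_eq_zero Q p).trans h1.le
    have hterm : ∀ i ∈ Q, (p i : ℝ) + d i + ((d i : ℝ) + 1) ^ 2 / c ≤ p i + 2 * M ^ 2 := by
      intro i hi
      have hdM := hlt i hi
      have hd0 : (0 : ℝ) ≤ d i := Nat.cast_nonneg _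
      have hquot : ((d i : ℝ) + 1) ^ 2 / c ≤ (M + 1) ^ 2 / 4 := by gcongr
      nlinarith
    have hsum := h2.trans (Finset.sum_le_sum hterm)
    rw [Finset.sum_add_distrib, Finset.sum_const, nsmul_eq_mul] at hsum
    have hp : ∑ i ∈ Q, (p i : ℝ) < b := by
      exact_mod_cast (Nat.le_add_right _ _).trans_lt h1
    have hcard' : (Q.card : ℝ) * (2 * M ^ 2) ≤ b * (2 * M ^ 2) := by gcongr
    linarith
  refine ⟨hex, ?_⟩
  obtain ⟨i, hi, hMi⟩ := hex
  have hsup : (d i : ℝ) ≤ (Q.sup d : ℕ) := by exact_mod_cast Finset.le_sup hi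
  rw [le_div_iff₀ hcpos]
  linarith
end
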